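/- Let τ ∈ ℂ with Im τ > 0, q := e^{2πiτ}. Let u, v ∈ ℂ∖(ℤ+ℤτ) with 2u, 2v, u+v ∉ ℤ+ℤτ, set x := e^{2πiu}, y := e^{2πiv}, √(xy) := e^{πi(u+v)}, and assume −x, −y ∉ q^ℤ := {q^m : m ∈ ℤ} and x/y ∉ q^ℤ. Then ((1−xy)(x−y)/((1−x)²(1−y)²)) · ₆ψ₆(q√(xy), −q√(xy), x, x, y, y; √(xy), −√(xy), qy, qy, qx, qx; q, q) = (x/q) · ((q+x)/(q−x)) · ((q;q)_∞²/θ(x²/q²)) · ₂ψ₆(−x, x/q; −x/q, x, 0, 0, 0, 0; q, x⁴/q²) − (y/q) · ((q+y)/(q−y)) · ((q;q)_∞²/θ(y²/q²)) · ₂ψ₆(−y, y/q; −y/q, y, 0, 0, 0, 0; q, y⁴/q²). -/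

import Mathlib

noncomputable section

/-- `e z = exp(2πiz)`. -/
def e (z : ℂ) : ℂ := Complex.exp (2 * (Real.pi : ℂ) * Complex.I * z)

/-- Infinite q-Pochhammer symbol `(a;q)_∞`. -/
def qpinf (a q : ℂ) : ℂ := ∏' j : ℕ, (1 - a * q ^ j)

/-- `(a;q)_n` for `n : ℤ`, defined as `(a;q)_∞ / (a q^n;q)_∞`. -/
def qpint (a q : ℂ) (n : ℤ) : ℂ := qpinf a q / qpinf (a * q ^ n) q

/-- `θ(x) = (x;q)_∞ (q/x;q)_∞`. -/
def qtheta (q x : ℂ) : ℂ := qpinf x q * qpinf (q / x) q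

/-- Weierstrass ℘-function for the lattice ℤ+ℤτ. -/
def wp (τ u : ℂ) : ℂ :=
  1 / u ^ 2 + ∑' p : ℤ × ℤ,
    if p = (0, 0) then 0
    else 1 / (u - ((p.1 : ℂ) + (p.2 : ℂ) * τ)) ^ 2 - 1 / ((p.1 : ℂ) + (p.2 : ℂ) * τ) ^ 2

/-- `₂ψ₆(-t, t/q; -t/q, t, 0, 0, 0, 0; q, t⁴/q²)`. -/
def psi26 (q t : ℂ) : ℂ :=
  ∑' n : ℤ,
    qpint (-t) q n * qpint (t / q) q n /
      (qpint (-t / q) q n * qpint t q n * qpint 0 q n * qpint 0 q n * qpint 0 q n *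
        qpint 0 q n) *
      ((-1 : ℂ) ^ n * q ^ ((n * (n - 1)) / 2)) ^ 4 * (t ^ 4 / q ^ 2) ^ n

/-- `₆ψ₆(q·s, -q·s, x, x, y, y; s, -s, qy, qy, qx, qx; q, q)` where `s = √(xy)`. -/
def psi66 (q s x y : ℂ) : ℂ :=
  ∑' n : ℤ,
    (qpint (q * s) q n * qpint (-(q * s)) q n * qpint x q n ^ 2 * qpint y q n ^ 2) /
      (qpint s q n * qpint (-s) q n * qpint (q * y) q n ^ 2 * qpint (q * x) q n ^ 2) * q ^ n

open Filter Topology Asymptotics Complex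

lemma e_add (a b : ℂ) : e (a + b) = e a * e b := by
  simp only [e, mul_add, Complex.exp_add]

lemma e_ne_zero (a : ℂ) : e a ≠ 0 := Complex.exp_ne_zero _

lemma e_neg (a : ℂ) : e (-a) = (e a)⁻¹ := by
  simp only [e, mul_neg, Complex.exp_neg]

lemma e_zero : e 0 = 1 := by simp [e]

lemma e_int_mul (k : ℤ) (a : ℂ) : e (k * a) = e a ^ k := by
  simp only [e, ← Complex.exp_int_mul]
  ring_nf

lemma e_two_mul (a : ℂ) : e (2 * a) = e a ^ 2 := by
  rw [two_mul, e_add, sq]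

lemma e_int (m : ℤ) : e m = 1 := by
  rw [e, mul_comm, Complex.exp_int_mul_two_pi_mul_I]

lemma e_add_int (a : ℂ) (m : ℤ) : e (a + m) = e a := by
  rw [e_add, e_int, mul_one]

lemma hasDerivAt_e (a : ℂ) : HasDerivAt e (2 * (Real.pi : ℂ) * Complex.I * e a) a := by
  have h := ((hasDerivAt_id a).const_mul (2 * (Real.pi : ℂ) * Complex.I)).cexp
  exact h.congr_deriv (by simp only [e, id]; ring)

lemma differentiable_e : Differentiable ℂ e := fun a => (hasDerivAt_e a).differentiableAt

lemma e_eq_zpow_iff (τ a : ℂ) (k : ℤ) : e a = e τ ^ k ↔ ∃ m : ℤ, a = m + k * τ := by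
  rw [← e_int_mul]
  constructor
  · intro h
    obtain ⟨m, hm⟩ := Complex.exp_eq_exp_iff_exists_int.1 h
    refine ⟨m, mul_left_cancel₀ Complex.two_pi_I_ne_zero ?_⟩
    rw [hm]
    ring
  · rintro ⟨m, rfl⟩
    rw [add_comm, e_add_int]

lemma norm_e_lt_one {τ : ℂ} (hτ : 0 < τ.im) : ‖e τ‖ < 1 := by
  simpa [e] using UpperHalfPlane.norm_exp_two_pi_I_lt_one ⟨τ, hτ⟩

section qPochhammer

variable {q : ℂ}

lemma summable_norm_mul_pow (hq : ‖q‖ < 1) (a : ℂ) : Summable fun j : ℕ => ‖-(a * q ^ j)‖ := by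
  simpa using (summable_geometric_of_lt_one (norm_nonneg q) hq).mul_left ‖a‖

lemma multipliable_one_sub_mul_pow (hq : ‖q‖ < 1) (a : ℂ) :
    Multipliable fun j : ℕ => 1 - a * q ^ j := by
  simpa [sub_eq_add_neg] using multipliable_one_add_of_summable (summable_norm_mul_pow hq a)

lemma qpinf_zero (q : ℂ) : qpinf 0 q = 1 := by simp [qpinf]

lemma qpinf_eq_zero_iff (hq : ‖q‖ < 1) (a : ℂ) : qpinf a q = 0 ↔ ∃ j : ℕ, a * q ^ j = 1 := by
  constructor
  · intro h
    by_contra! H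
    refine tprod_one_add_ne_zero_of_summable (f := fun j : ℕ => -(a * q ^ j)) (fun j => ?_)
      (summable_norm_mul_pow hq a) (by simpa [qpinf, sub_eq_add_neg] using h)
    rw [← sub_eq_add_neg]
    exact sub_ne_zero.2 (H j).symm
  · rintro ⟨j, hj⟩
    exact tprod_of_exists_eq_zero ⟨j, by simp [hj]⟩

lemma qpinf_eq (hq : ‖q‖ < 1) (a : ℂ) : qpinf a q = (1 - a) * qpinf (a * q) q := by
  have h : Multipliable fun j : ℕ => 1 - a * q ^ (j + 1) := by
    simpa [pow_succ', mul_assoc] using multipliable_one_sub_mul_pow hq (a * q)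
  have h' : qpinf a q = (1 - a * q ^ 0) * ∏' j : ℕ, (1 - a * q ^ (j + 1)) :=
    tprod_eq_zero_mul' h
  simp_rw [h', qpinf, pow_succ', pow_zero, mul_one, mul_assoc]

lemma differentiable_qpinf (hq : ‖q‖ < 1) : Differentiable ℂ fun a => qpinf a q := by
  intro a
  have hU : IsOpen (Metric.ball (0 : ℂ) (‖a‖ + 1)) := Metric.isOpen_ball
  have h := Summable.hasProdLocallyUniformlyOn_nat_one_add
    (f := fun (j : ℕ) (z : ℂ) => -(z * q ^ j)) hU
    ((summable_geometric_of_lt_one (norm_nonneg q) hq).mul_left (‖a‖ + 1))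
    (Eventually.of_forall fun j z hz => by
      rw [norm_neg, norm_mul, norm_pow]
      gcongr
      simpa using (Metric.mem_ball.1 hz).le)
    (fun j => by fun_prop)
  have hd := h.differentiableOn (Eventually.of_forall fun s => by
    refine DifferentiableOn.fun_finsetProd fun j _ => by fun_prop) hU
  have := hd.differentiableAt (hU.mem_nhds (x := a) (by simp))
  simpa [qpinf, sub_eq_add_neg] using this

/-- No shift of `a` by a power of `q` is a zero of the `q`-Pochhammer symbol. -/
lemma qpinf_mul_zpow_ne_zero (hq : ‖q‖ < 1) (hq0 : q ≠ 0) {a : ℂ} (ha : ∀ n : ℤ, a * q ^ n ≠ 1)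
    (n : ℤ) : qpinf (a * q ^ n) q ≠ 0 := by
  rw [Ne, qpinf_eq_zero_iff hq]
  rintro ⟨j, hj⟩
  refine ha (n + j) ?_
  rw [zpow_add₀ hq0, zpow_natCast, ← mul_assoc, hj]

lemma qpint_ne_zero (hq : ‖q‖ < 1) (hq0 : q ≠ 0) {a : ℂ} (ha : ∀ n : ℤ, a * q ^ n ≠ 1)
    (n : ℤ) : qpint a q n ≠ 0 :=
  div_ne_zero (by simpa using qpinf_mul_zpow_ne_zero hq hq0 ha 0)
    (qpinf_mul_zpow_ne_zero hq hq0 ha n)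

lemma qpint_zero (q : ℂ) (n : ℤ) : qpint 0 q n = 1 := by simp [qpint, qpinf_zero]

lemma qpint_mul_left (hq : ‖q‖ < 1) (hq0 : q ≠ 0) {a : ℂ} (ha : ∀ n : ℤ, a * q ^ n ≠ 1) (n : ℤ) :
    qpint (q * a) q n = qpint a q n * ((1 - a * q ^ n) / (1 - a)) := by
  have h1 : 1 - a ≠ 0 := sub_ne_zero.2 (by simpa using (ha 0).symm)
  have h2 : 1 - a * q ^ n ≠ 0 := sub_ne_zero.2 (ha n).symm
  have h3 := qpinf_mul_zpow_ne_zero hq hq0 ha n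
  have e1 : a * q ^ n * q = a * q * q ^ n := by ring
  rw [qpinf_eq hq, e1] at h3
  have h4 := right_ne_zero_of_mul h3
  rw [qpint, qpint, qpinf_eq hq a, qpinf_eq hq (a * q ^ n), e1, mul_comm q a]
  field_simp

end qPochhammer

section theta

variable {q : ℂ}

lemma qtheta_mul_left (hq : ‖q‖ < 1) (hq0 : q ≠ 0) {z : ℂ} (hz : z ≠ 0) :
    qtheta q (q * z) = -z⁻¹ * qtheta q z := by
  have h1 : q / (q * z) = z⁻¹ := by field_simp
  rw [qtheta, qtheta, h1, qpinf_eq hq z⁻¹, qpinf_eq hq z, mul_comm q z, inv_mul_eq_div]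
  field_simp
  ring

lemma qtheta_inv (hq : ‖q‖ < 1) {z : ℂ} (hz : z ≠ 0) :
    qtheta q z⁻¹ = -z⁻¹ * qtheta q z := by
  rw [qtheta, qtheta, div_inv_eq_mul, qpinf_eq hq z⁻¹, qpinf_eq hq z, mul_comm q z, inv_mul_eq_div]
  field_simp
  ring

lemma qtheta_eq_zero (hq : ‖q‖ < 1) (hq0 : q ≠ 0) {z : ℂ} (h : qtheta q z = 0) :
    ∃ k : ℤ, z = q ^ k := by
  rcases mul_eq_zero.1 h with h | h <;> obtain ⟨j, hj⟩ := (qpinf_eq_zero_iff hq _).1 h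
  · exact ⟨-j, by rw [zpow_neg, zpow_natCast, eq_inv_of_mul_eq_one_left hj]⟩
  · refine ⟨j + 1, ?_⟩
    have hz : z ≠ 0 := by
      rintro rfl
      simp at hj
    rw [zpow_add_one₀ hq0, zpow_natCast]
    field_simp at hj
    linear_combination -hj

lemma exists_qtheta_zpow_mul (hq : ‖q‖ < 1) (hq0 : q ≠ 0) (k : ℤ) :
    ∃ c : ℂ, c ≠ 0 ∧ ∀ z ≠ 0, qtheta q (q ^ k * z) = c * z ^ (-k) * qtheta q z := by
  induction k with
  | zero => exact ⟨1, one_ne_zero, fun z _ => by simp⟩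
  | succ i ih =>
    obtain ⟨c, hc, h⟩ := ih
    refine ⟨-(q ^ (-i : ℤ) * c), neg_ne_zero.2 (mul_ne_zero (zpow_ne_zero _ hq0) hc),
      fun z hz => ?_⟩
    rw [zpow_add_one₀ hq0, mul_assoc, h _ (mul_ne_zero hq0 hz), qtheta_mul_left hq hq0 hz,
      mul_zpow, neg_add, zpow_add₀ hz, zpow_neg_one]
    ring
  | pred i ih =>
    obtain ⟨c, hc, h⟩ := ih
    refine ⟨-(q ^ (-i - 1 : ℤ) * c), neg_ne_zero.2 (mul_ne_zero (zpow_ne_zero _ hq0) hc),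
      fun z hz => ?_⟩
    have hw : q⁻¹ * z ≠ 0 := mul_ne_zero (inv_ne_zero hq0) hz
    have h2 := qtheta_mul_left hq hq0 hw
    rw [mul_inv_cancel_left₀ hq0] at h2
    have h3 : -(-(i : ℤ) - 1) = i + 1 := by ring
    rw [zpow_sub_one₀ hq0, mul_assoc, h _ hw, h2, h3, mul_zpow, zpow_add_one₀ hz, neg_neg,
      inv_zpow, zpow_neg]
    field_simp

end theta

section series

/-- The general term of the Lambert series `∑ x qⁿ / (1 - x qⁿ)²`. -/
def lambertTerm (q : ℂ) (n : ℤ) (x : ℂ) : ℂ := x * q ^ n / (1 - x * q ^ n) ^ 2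

/-- The general term of the Appell–Lerch series `∑ q^(2 n²) x^(4 n) (1 + x qⁿ) / (1 - x qⁿ)`. -/
def appellTerm (q : ℂ) (n : ℤ) (x : ℂ) : ℂ :=
  q ^ (2 * n ^ 2) * x ^ (4 * n) * ((1 + x * q ^ n) / (1 - x * q ^ n))

variable {q : ℂ}

lemma norm_div_one_sub_le {z : ℂ} {t : ℝ} (ht : t ≤ 1 / 2) (hz : ‖z‖ ≤ t) :
    1 - z ≠ 0 ∧ ‖z / (1 - z) ^ 2‖ ≤ 4 * t ∧ ‖(1 + z) / (1 - z)‖ ≤ 3 := by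
  have h1 : 1 / 2 ≤ ‖1 - z‖ := by
    have := norm_sub_norm_le 1 z
    rw [norm_one] at this
    linarith
  have h2 : ‖1 + z‖ ≤ 3 / 2 := by
    have := norm_add_le 1 z
    rw [norm_one] at this
    linarith
  have h0 : 0 < ‖1 - z‖ := by linarith
  refine ⟨norm_pos_iff.1 h0, ?_, ?_⟩
  · rw [norm_div, norm_pow, div_le_iff₀ (by positivity)]
    nlinarith [norm_nonneg z, mul_le_mul h1 h1 (by norm_num) h0.le]
  · rw [norm_div, div_le_iff₀ h0]
    linarith

lemma norm_div_one_sub_le_of_inv {z : ℂ} {t : ℝ} (hz0 : z ≠ 0) (ht : t ≤ 1 / 2)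
    (hz : ‖z⁻¹‖ ≤ t) :
    1 - z ≠ 0 ∧ ‖z / (1 - z) ^ 2‖ ≤ 4 * t ∧ ‖(1 + z) / (1 - z)‖ ≤ 3 := by
  obtain ⟨h1, h2, h3⟩ := norm_div_one_sub_le ht hz
  have h4 : 1 - z = -z * (1 - z⁻¹) := by field_simp; ring
  have h5 : z / (1 - z) ^ 2 = z⁻¹ / (1 - z⁻¹) ^ 2 := by rw [h4]; field_simp
  have h6 : (1 + z) / (1 - z) = -((1 + z⁻¹) / (1 - z⁻¹)) := by
    rw [h4]; field_simp; ring
  refine ⟨?_, h5 ▸ h2, by rwa [h6, norm_neg]⟩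
  rw [h4]
  exact mul_ne_zero (neg_ne_zero.2 hz0) h1

lemma exists_bound_terms (hq : ‖q‖ < 1) (hq0 : q ≠ 0) {x₀ : ℂ} (hx₀ : x₀ ≠ 0) :
    ∃ (N : ℕ) (C : ℝ), ∀ᶠ x in 𝓝 x₀, x ≠ 0 ∧ ∀ n : ℤ, N ≤ n.natAbs →
      1 - x * q ^ n ≠ 0 ∧ ‖lambertTerm q n x‖ ≤ C * ‖q‖ ^ n.natAbs ∧
        ‖appellTerm q n x‖ ≤ C * ‖q‖ ^ n.natAbs := by
  obtain ⟨R, hR1, hR2, hR3⟩ : ∃ R : ℝ, 1 ≤ R ∧ ‖x₀‖ < R ∧ ‖x₀⁻¹‖ < R :=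
    ⟨max ‖x₀‖ ‖x₀⁻¹‖ + 1, by have := norm_nonneg x₀; have := le_max_left ‖x₀‖ ‖x₀⁻¹‖; linarith,
      by have := le_max_left ‖x₀‖ ‖x₀⁻¹‖; linarith, by have := le_max_right ‖x₀‖ ‖x₀⁻¹‖; linarith⟩
  have hq' : 0 < ‖q‖ := norm_pos_iff.2 hq0
  obtain ⟨N, hN⟩ := exists_pow_lt_of_lt_one (show 0 < 1 / (2 * R ^ 4) by positivity) hq
  refine ⟨N, 4 * R, ?_⟩
  filter_upwards [continuousAt_id.norm.eventually_lt_const hR2,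
    (continuousAt_inv₀ hx₀).norm.eventually_lt_const hR3,
    isOpen_ne.mem_nhds hx₀] with x hx1 hx2 hx0
  refine ⟨hx0, fun n hn => ?_⟩
  simp only [id] at hx1
  set k := n.natAbs with hk
  have hqk : R ^ 4 * ‖q‖ ^ k ≤ 1 / 2 := by
    have : ‖q‖ ^ k ≤ ‖q‖ ^ N := pow_le_pow_of_le_one hq'.le hq.le hn
    have h := this.trans hN.le
    rw [le_div_iff₀ (by positivity)] at h
    linarith
  have ht : R * ‖q‖ ^ k ≤ 1 / 2 := by
    refine le_trans ?_ hqk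
    gcongr
    exact le_self_pow₀ hR1 (by norm_num)
  have hz0 : x * q ^ n ≠ 0 := mul_ne_zero hx0 (zpow_ne_zero _ hq0)
  have hsgn : n = k ∨ n = -k := by omega
  have key : 1 - x * q ^ n ≠ 0 ∧ ‖x * q ^ n / (1 - x * q ^ n) ^ 2‖ ≤ 4 * (R * ‖q‖ ^ k) ∧
      ‖(1 + x * q ^ n) / (1 - x * q ^ n)‖ ≤ 3 := by
    rcases hsgn with h | h
    · refine norm_div_one_sub_le ht ?_
      rw [h, norm_mul, zpow_natCast, norm_pow]
      gcongr
    · refine norm_div_one_sub_le_of_inv hz0 ht ?_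
      rw [h, mul_inv, zpow_neg, inv_inv, norm_mul, zpow_natCast, norm_pow]
      gcongr
  have hpow : ‖x ^ (4 * n)‖ ≤ (R ^ 4) ^ k := by
    rcases hsgn with h | h
    · rw [h, zpow_mul, zpow_natCast, norm_pow, zpow_ofNat, norm_pow]
      gcongr
    · rw [h, zpow_mul, zpow_neg, ← inv_zpow, zpow_natCast, norm_pow, zpow_ofNat, norm_inv,
        norm_pow, ← inv_pow, ← norm_inv]
      gcongr
  have hqpow : ‖q ^ (2 * n ^ 2)‖ = ((‖q‖ ^ k) * (‖q‖ ^ k)) ^ k := by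
    have : (2 * n ^ 2 : ℤ) = ((2 * k ^ 2 : ℕ) : ℤ) := by
      rw [hk]; push_cast; rw [sq_abs]
    rw [this, zpow_natCast, norm_pow, ← pow_add, ← pow_mul]
    congr 1
    ring
  refine ⟨key.1, by simpa only [lambertTerm, mul_assoc] using key.2.1, ?_⟩
  have hprod : ‖q ^ (2 * n ^ 2) * x ^ (4 * n)‖ ≤ ‖q‖ ^ k := by
    rw [norm_mul, hqpow]
    calc ((‖q‖ ^ k) * (‖q‖ ^ k)) ^ k * ‖x ^ (4 * n)‖
        ≤ ((‖q‖ ^ k) * (‖q‖ ^ k)) ^ k * (R ^ 4) ^ k := by gcongr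
      _ = ((R ^ 4 * ‖q‖ ^ k) * ‖q‖ ^ k) ^ k := by rw [← mul_pow]; ring
      _ ≤ (1 * ‖q‖ ^ k) ^ k := by gcongr; linarith
      _ ≤ ‖q‖ ^ k := by
        rw [one_mul, ← pow_mul]
        exact pow_le_pow_of_le_one hq'.le hq.le (Nat.le_mul_self k)
  rw [appellTerm, norm_mul]
  calc _ ≤ ‖q‖ ^ k * 3 := by gcongr; exact key.2.2
    _ ≤ 4 * R * ‖q‖ ^ k := by nlinarith [pow_pos hq' k]

lemma summable_norm_pow_natAbs (hq : ‖q‖ < 1) : Summable fun n : ℤ => ‖q‖ ^ n.natAbs := by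
  have h := summable_geometric_of_lt_one (norm_nonneg q) hq
  exact Summable.of_nat_of_neg (by simpa using h) (by simpa using h)

lemma finite_setOf_natAbs_lt (N : ℕ) : {n : ℤ | n.natAbs < N}.Finite :=
  (Set.finite_Icc (-N : ℤ) N).subset fun n hn => by
    simp only [Set.mem_ofPred_eq, Set.mem_Icc] at *
    omega

/-- A bilateral series of holomorphic functions is holomorphic at a point near which all but
finitely many terms admit a summable bound. -/
lemma differentiableAt_tsum_int {f : ℤ → ℂ → ℂ} {x₀ : ℂ} {b : ℤ → ℝ} (hb : Summable b) (N : ℕ)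
    (hN : ∀ᶠ x in 𝓝 x₀, ∀ n : ℤ, N ≤ n.natAbs → DifferentiableAt ℂ (f n) x ∧ ‖f n x‖ ≤ b n)
    (hf : ∀ n, ∀ᶠ x in 𝓝 x₀, DifferentiableAt ℂ (f n) x) :
    DifferentiableAt ℂ (fun x => ∑' n, f n x) x₀ := by
  let b' : ℤ → ℝ := fun n => if n.natAbs < N then ‖f n x₀‖ + 1 else b n
  have hb' : Summable b' := by
    refine hb.congr_cofinite ?_
    filter_upwards [(finite_setOf_natAbs_lt N).compl_mem_cofinite] with n hn
    exact (if_neg hn).symm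
  have hev : ∀ᶠ x in 𝓝 x₀, ∀ n, DifferentiableAt ℂ (f n) x ∧ ‖f n x‖ ≤ b' n := by
    have hfin : ∀ᶠ x in 𝓝 x₀, ∀ n ∈ {n : ℤ | n.natAbs < N},
        DifferentiableAt ℂ (f n) x ∧ ‖f n x‖ ≤ ‖f n x₀‖ + 1 :=
      (eventually_all_finite (finite_setOf_natAbs_lt N)).2 fun n _ =>
        (hf n).and (((hf n).self_of_nhds.continuousAt.norm.eventually_lt_const
          (lt_add_one _)).mono fun _ => le_of_lt)
    filter_upwards [hN, hfin] with x h1 h2 n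
    by_cases hn : n.natAbs < N
    · simpa only [b', if_pos hn] using h2 n hn
    · simpa only [b', if_neg hn] using h1 n (not_lt.1 hn)
  obtain ⟨U, hU, hUo, hxU⟩ := eventually_nhds_iff.1 hev
  exact (differentiableOn_tsum_of_summable_norm hb'
    (fun n x hx => (hU x hx n).1.differentiableWithinAt) hUo
    (fun n x hx => (hU x hx n).2)).differentiableAt (hUo.mem_nhds hxU)

lemma differentiableAt_lambertTerm {n : ℤ} {x : ℂ} (h : 1 - x * q ^ n ≠ 0) :
    DifferentiableAt ℂ (lambertTerm q n) x := by
  unfold lambertTerm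
  fun_prop (disch := exact pow_ne_zero 2 h)

lemma differentiableAt_appellTerm {n : ℤ} {x : ℂ} (hx : x ≠ 0) (h : 1 - x * q ^ n ≠ 0) :
    DifferentiableAt ℂ (appellTerm q n) x := by
  unfold appellTerm
  have := differentiableAt_zpow (𝕜 := ℂ) (x := x) (m := 4 * n) |>.2 (Or.inl hx)
  fun_prop (disch := exact h)

lemma eventually_one_sub_mul_zpow_ne_zero {n : ℤ} {x₀ : ℂ} (h : x₀ * q ^ n ≠ 1) :
    ∀ᶠ x in 𝓝 x₀, 1 - x * q ^ n ≠ 0 :=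
  ContinuousAt.eventually_ne (g := fun x : ℂ => 1 - x * q ^ n) (by fun_prop)
    (sub_ne_zero.2 h.symm)

lemma summable_terms (hq : ‖q‖ < 1) (hq0 : q ≠ 0) {x : ℂ} (hx : x ≠ 0) :
    Summable (fun n => lambertTerm q n x) ∧ Summable (fun n => appellTerm q n x) := by
  obtain ⟨N, C, h⟩ := exists_bound_terms hq hq0 hx
  have h' := h.self_of_nhds.2
  have hs := (summable_norm_pow_natAbs hq).mul_left C
  have hc := (finite_setOf_natAbs_lt N).compl_mem_cofinite
  constructor <;>
  · refine Summable.of_norm_bounded_eventually hs ?_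
    filter_upwards [hc] with n hn
    first
    | exact (h' n (not_lt.1 hn)).2.1
    | exact (h' n (not_lt.1 hn)).2.2

lemma differentiableAt_tsum_terms (hq : ‖q‖ < 1) (hq0 : q ≠ 0) {x₀ : ℂ} (hx₀ : x₀ ≠ 0)
    (J : Finset ℤ) (hJ : ∀ n ∉ J, x₀ * q ^ n ≠ 1) :
    DifferentiableAt ℂ (fun x => ∑' n, if n ∈ J then 0 else lambertTerm q n x) x₀ ∧
      DifferentiableAt ℂ (fun x => ∑' n, if n ∈ J then 0 else appellTerm q n x) x₀ := by
  obtain ⟨N, C, h⟩ := exists_bound_terms hq hq0 hx₀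
  have hC : ∀ n : ℤ, N ≤ n.natAbs → 0 ≤ C * ‖q‖ ^ n.natAbs := fun n hn =>
    (norm_nonneg _).trans (h.self_of_nhds.2 n hn).2.1
  have hs := (summable_norm_pow_natAbs hq).mul_left C
  have h0 : ∀ᶠ x in 𝓝 x₀, x ≠ 0 := isOpen_ne.mem_nhds hx₀
  constructor
  · refine differentiableAt_tsum_int hs N ?_ fun n => ?_
    · filter_upwards [h] with x hx n hn
      by_cases hnJ : n ∈ J
      · simpa [hnJ] using hC n hn
      · simpa only [if_neg hnJ] using
          ⟨differentiableAt_lambertTerm (hx.2 n hn).1, (hx.2 n hn).2.1⟩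
    · by_cases hnJ : n ∈ J
      · simp [hnJ]
      · simp only [if_neg hnJ]
        filter_upwards [eventually_one_sub_mul_zpow_ne_zero (hJ n hnJ)] with x hx
        exact differentiableAt_lambertTerm hx
  · refine differentiableAt_tsum_int hs N ?_ fun n => ?_
    · filter_upwards [h] with x hx n hn
      by_cases hnJ : n ∈ J
      · simpa [hnJ] using hC n hn
      · simpa only [if_neg hnJ] using
          ⟨differentiableAt_appellTerm hx.1 (hx.2 n hn).1, (hx.2 n hn).2.2⟩
    · by_cases hnJ : n ∈ J
      · simp [hnJ]
      · simp only [if_neg hnJ]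
        filter_upwards [eventually_one_sub_mul_zpow_ne_zero (hJ n hnJ), h0] with x hx hx0
        exact differentiableAt_appellTerm hx0 hx

/-- The Lambert series `∑ x qⁿ / (1 - x qⁿ)²`. -/
def lambertSum (q x : ℂ) : ℂ := ∑' n : ℤ, lambertTerm q n x

/-- The Appell–Lerch series `∑ q^(2 n²) x^(4 n) (1 + x qⁿ) / (1 - x qⁿ)`. -/
def appellSum (q x : ℂ) : ℂ := ∑' n : ℤ, appellTerm q n x

lemma one_add_inv_div_one_sub_inv {z : ℂ} (hz : z ≠ 0) :
    (1 + z⁻¹) / (1 - z⁻¹) = -((1 + z) / (1 - z)) := by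
  have h1 : 1 - z⁻¹ = -z⁻¹ * (1 - z) := by field_simp; ring
  have h2 : 1 + z⁻¹ = z⁻¹ * (1 + z) := by field_simp; ring
  rw [h1, h2, neg_mul, div_neg, mul_div_mul_left _ _ (inv_ne_zero hz)]

lemma lambertSum_mul_left (hq0 : q ≠ 0) (x : ℂ) : lambertSum q (q * x) = lambertSum q x := by
  rw [lambertSum, lambertSum,
    ← (Equiv.addRight (1 : ℤ)).tsum_eq (fun n => lambertTerm q n x)]
  refine tsum_congr fun n => ?_
  have : q * x * q ^ n = x * q ^ (n + 1) := by rw [zpow_add_one₀ hq0]; ring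
  simp only [lambertTerm, this, Equiv.coe_addRight]

lemma lambertSum_inv (hq0 : q ≠ 0) {x : ℂ} (hx : x ≠ 0) :
    lambertSum q x⁻¹ = lambertSum q x := by
  rw [lambertSum, lambertSum, ← (Equiv.neg ℤ).tsum_eq]
  refine tsum_congr fun n => ?_
  have hz : x * q ^ n ≠ 0 := mul_ne_zero hx (zpow_ne_zero _ hq0)
  have h : x⁻¹ * q ^ (-n) = (x * q ^ n)⁻¹ := by rw [mul_inv, zpow_neg]
  simp only [lambertTerm, Equiv.neg_apply, h]
  generalize x * q ^ n = z at hz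
  have h1 : (1 - z⁻¹) ^ 2 = z⁻¹ ^ 2 * (1 - z) ^ 2 := by field_simp; ring
  rw [h1, sq z⁻¹, mul_assoc, ← div_div, div_self (inv_ne_zero hz), ← div_div, one_div, inv_inv]

lemma appellSum_mul_left (hq0 : q ≠ 0) {x : ℂ} (hx : x ≠ 0) :
    appellSum q (q * x) = (q ^ 2 * x ^ 4)⁻¹ * appellSum q x := by
  rw [appellSum, appellSum, ← tsum_mul_left,
    ← (Equiv.addRight (1 : ℤ)).tsum_eq (fun n => (q ^ 2 * x ^ 4)⁻¹ * appellTerm q n x)]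
  refine tsum_congr fun n => ?_
  have h1 : q * x * q ^ n = x * q ^ (n + 1) := by rw [zpow_add_one₀ hq0]; ring
  have h2 : q ^ (2 * (n + 1) ^ 2) = q ^ (2 * n ^ 2) * q ^ (4 * n) * q ^ 2 := by
    rw [← zpow_natCast, ← zpow_add₀ hq0, ← zpow_add₀ hq0]
    congr 1
    push_cast
    ring
  have h3 : x ^ (4 * (n + 1)) = x ^ (4 * n) * x ^ 4 := by
    rw [← zpow_natCast, ← zpow_add₀ hx]
    congr 1
    push_cast
    ring
  simp only [appellTerm, Equiv.coe_addRight, h1, h2, h3, mul_zpow]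
  field_simp

lemma appellSum_inv (hq0 : q ≠ 0) {x : ℂ} (hx : x ≠ 0) :
    appellSum q x⁻¹ = -appellSum q x := by
  rw [appellSum, appellSum, ← tsum_neg, ← (Equiv.neg ℤ).tsum_eq]
  refine tsum_congr fun n => ?_
  have hz : x * q ^ n ≠ 0 := mul_ne_zero hx (zpow_ne_zero _ hq0)
  have h : x⁻¹ * q ^ (-n) = (x * q ^ n)⁻¹ := by rw [mul_inv, zpow_neg]
  simp only [appellTerm, Equiv.neg_apply, h, one_add_inv_div_one_sub_inv hz, neg_sq, mul_neg]
  rw [inv_zpow, zpow_neg, inv_inv]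

/-- The elliptic normalisation of the Appell–Lerch series. -/
def appellQuot (q x : ℂ) : ℂ := x * qpinf q q ^ 2 / qtheta q (x ^ 2) * appellSum q x

lemma appellQuot_mul_left (hq : ‖q‖ < 1) (hq0 : q ≠ 0) {x : ℂ} (hx : x ≠ 0) :
    appellQuot q (q * x) = appellQuot q x := by
  have h : (q * x) ^ 2 = q * (q * x ^ 2) := by ring
  have hx2 : x ^ 2 ≠ 0 := pow_ne_zero 2 hx
  rw [appellQuot, appellQuot, h, qtheta_mul_left hq hq0 (mul_ne_zero hq0 hx2),
    qtheta_mul_left hq hq0 hx2, appellSum_mul_left hq0 hx]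
  field_simp

lemma appellQuot_inv (hq : ‖q‖ < 1) (hq0 : q ≠ 0) {x : ℂ} (hx : x ≠ 0) :
    appellQuot q x⁻¹ = appellQuot q x := by
  rw [appellQuot, appellQuot, inv_pow, qtheta_inv hq (pow_ne_zero 2 hx), appellSum_inv hq0 hx]
  field_simp

end series

section elliptic

/-- A function that is symmetric about `z₀` and has at most a double pole there, with vanishing
leading coefficient, is `o((z - z₀)⁻¹)`. -/
lemma isLittleO_inv_of_symmetric {D h : ℂ → ℂ} {z₀ : ℂ} (hh : DifferentiableAt ℂ h 0)
    (h0 : h 0 = 0) (hD : ∀ᶠ w in 𝓝[≠] (0 : ℂ), D (z₀ + w) * w ^ 2 = h w)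
    (hsymm : ∀ w, D (z₀ - w) = D (z₀ + w)) : D =o[𝓝[≠] z₀] fun z => (z - z₀)⁻¹ := by
  have hneg : Tendsto (fun w : ℂ => -w) (𝓝[≠] 0) (𝓝[≠] 0) := by
    refine tendsto_nhdsWithin_iff.2 ⟨?_, ?_⟩
    · simpa using (continuous_neg (G := ℂ)).continuousAt.tendsto.mono_left
        (nhdsWithin_le_nhds (a := (0 : ℂ)) (s := {0}ᶜ))
    · filter_upwards [self_mem_nhdsWithin] with w hw
      simpa using hw
  have heven : (fun w => h (-w)) =ᶠ[𝓝 0] h := by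
    have h1 : ∀ᶠ w in 𝓝[≠] (0 : ℂ), h (-w) = h w := by
      filter_upwards [hD, hneg.eventually hD] with w h1 h2
      rw [← h1, ← h2, ← sub_eq_add_neg, hsymm, neg_sq]
    filter_upwards [eventually_nhdsWithin_iff.1 h1] with w hw
    by_cases hw0 : w = 0
    · simp [hw0]
    · exact hw hw0
  have hd : HasDerivAt h (deriv h 0) 0 := hh.hasDerivAt
  have hd' : HasDerivAt (fun w => h (-w)) (-deriv h 0) 0 := by
    have h1 : HasDerivAt h (deriv h 0) (-0) := by simpa using hd
    exact (h1.comp (0 : ℂ) (hasDerivAt_neg (0 : ℂ))).congr_deriv (by ring)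
  have hz : deriv h 0 = 0 := by
    have := hd.unique (hd'.congr_of_eventuallyEq heven.symm)
    linear_combination this / 2
  rw [hasDerivAt_iff_isLittleO, hz, h0] at hd
  simp only [sub_zero, smul_zero] at hd
  have key : (fun w => D (z₀ + w)) =o[𝓝[≠] 0] fun w => w⁻¹ := by
    have h1 : (fun w => h w * (w ^ 2)⁻¹) =o[𝓝[≠] 0] fun w => w * (w ^ 2)⁻¹ :=
      (hd.mono nhdsWithin_le_nhds).mul_isBigO (isBigO_refl _ _)
    refine h1.congr' ?_ ?_
    · filter_upwards [hD, self_mem_nhdsWithin] with w h2 hw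
      have hw0 : w ≠ 0 := hw
      rw [← h2]
      field_simp
    · filter_upwards [self_mem_nhdsWithin] with w hw
      have hw0 : w ≠ 0 := hw
      field_simp
  have ht : Tendsto (fun z : ℂ => z - z₀) (𝓝[≠] z₀) (𝓝[≠] 0) := by
    refine tendsto_nhdsWithin_iff.2 ⟨?_, ?_⟩
    · have : ContinuousAt (fun z : ℂ => z - z₀) z₀ := by fun_prop
      simpa using this.tendsto.mono_left nhdsWithin_le_nhds
    · filter_upwards [self_mem_nhdsWithin] with w hw
      exact sub_ne_zero.2 hw
  simpa [Function.comp_def] using key.comp_tendsto ht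

lemma isLittleO_const_sub_inv (c z₀ : ℂ) :
    (fun _ : ℂ => c) =o[𝓝[≠] z₀] fun z => (z - z₀)⁻¹ := by
  have h : IsBoundedUnder (· ≤ ·) (𝓝[≠] z₀)
      (norm ∘ fun z =>
        Function.update (fun _ => c) z₀ 0 z - Function.update (fun _ => c) z₀ 0 z₀) := by
    refine isBoundedUnder_of_eventually_le (a := ‖c‖) ?_
    filter_upwards [self_mem_nhdsWithin] with w hw
    have hw0 : w ≠ z₀ := hw
    simp [hw0]
  refine h.isLittleO_sub_self_inv.congr' ?_ EventuallyEq.rfl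
  filter_upwards [self_mem_nhdsWithin] with w hw
  have hw0 : w ≠ z₀ := hw
  simp [hw0]

lemma ContinuousAt.isLittleO_sub_inv {D : ℂ → ℂ} {z₀ : ℂ} (h : ContinuousAt D z₀) :
    D =o[𝓝[≠] z₀] fun z => (z - z₀)⁻¹ :=
  ((h.tendsto.mono_left nhdsWithin_le_nhds).isBigO_one ℂ).trans_isLittleO
    (isLittleO_const_sub_inv 1 z₀)

/-- A function with only removable singularities extends to an entire function. -/
lemma differentiable_limUnder {D : ℂ → ℂ}
    (hd : ∀ z, ∀ᶠ w in 𝓝[≠] z, DifferentiableAt ℂ D w)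
    (ho : ∀ z₀, D =o[𝓝[≠] z₀] fun z => (z - z₀)⁻¹) :
    Differentiable ℂ fun z => limUnder (𝓝[≠] z) D := by
  intro c
  have hs := eventually_nhdsWithin_iff.1 (hd c)
  have hu : DifferentiableOn ℂ (Function.update D c (limUnder (𝓝[≠] c) D))
      {w | w ∈ ({c}ᶜ : Set ℂ) → DifferentiableAt ℂ D w} :=
    Complex.differentiableOn_update_limUnder_of_isLittleO hs
      (fun w hw => (hw.1 hw.2).differentiableWithinAt)
      ((ho c).sub (isLittleO_const_sub_inv _ c))
  refine (hu.differentiableAt hs).congr_of_eventuallyEq ?_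
  filter_upwards [hs] with w hw
  by_cases hwc : w = c
  · simp [hwc]
  · rw [Function.update_of_ne hwc]
    exact ((hw hwc).continuousAt.tendsto.mono_left nhdsWithin_le_nhds).limUnder_eq

lemma limUnder_nhdsNE_add {D : ℂ → ℂ} {c : ℂ} (h : Function.Periodic D c) (z : ℂ) :
    limUnder (𝓝[≠] (z + c)) D = limUnder (𝓝[≠] z) D := by
  have h1 : map (fun w => w + c) (𝓝[≠] z) = 𝓝[≠] (z + c) := by
    exact (Homeomorph.addRight c).map_punctured_nhds_eq z
  have h2 : D ∘ (fun w => w + c) = D := funext h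
  rw [limUnder, ← h1, map_map, h2, limUnder]

/-- An entire function with two independent periods is constant. -/
lemma eq_of_periodic_of_differentiable {g : ℂ → ℂ} {τ : ℂ} (hτ : 0 < τ.im)
    (hg : Differentiable ℂ g) (h1 : Function.Periodic g 1) (h2 : Function.Periodic g τ) (z w : ℂ) :
    g z = g w := by
  refine hg.apply_eq_apply_of_bounded ?_ z w
  let P : ℝ × ℝ → ℂ := fun p => p.1 + p.2 * τ
  have hP : Continuous P := by fun_prop
  have hK : IsCompact (P '' (Set.Icc 0 1 ×ˢ Set.Icc 0 1)) :=
    (isCompact_Icc.prod isCompact_Icc).image hP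
  refine (hK.image hg.continuous).isBounded.subset ?_
  rintro _ ⟨z, rfl⟩
  set b : ℝ := z.im / τ.im
  set a : ℝ := z.re - b * τ.re
  have hz : z = a + b * τ := by
    apply Complex.ext
    · simp [a]
    · simp [b, hτ.ne']
  refine ⟨_, ⟨(Int.fract a, Int.fract b), ⟨⟨Int.fract_nonneg _, (Int.fract_lt_one _).le⟩,
    ⟨Int.fract_nonneg _, (Int.fract_lt_one _).le⟩⟩, rfl⟩, ?_⟩
  have h3 : P (Int.fract a, Int.fract b) = z - (⌊a⌋ : ℂ) * 1 - (⌊b⌋ : ℂ) * τ := by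
    rw [hz]
    simp only [P, Int.fract]
    push_cast
    ring
  rw [h3, h2.sub_int_mul_eq, h1.sub_int_mul_eq]

end elliptic

section appell

variable {q : ℂ}

lemma qtheta_eq (hq : ‖q‖ < 1) (z : ℂ) :
    qtheta q z = (1 - z) * (qpinf (q * z) q * qpinf (q / z) q) := by
  rw [qtheta, qpinf_eq hq z, mul_comm z q, mul_assoc]

lemma qtheta_zpow (hq : ‖q‖ < 1) (hq0 : q ≠ 0) (k : ℤ) : qtheta q (q ^ k) = 0 := by
  obtain ⟨c, -, h⟩ := exists_qtheta_zpow_mul hq hq0 k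
  rw [← mul_one (q ^ k), h 1 one_ne_zero, qtheta_eq hq]
  simp

lemma qpinf_self_ne_zero (hq : ‖q‖ < 1) : qpinf q q ≠ 0 := by
  rw [Ne, qpinf_eq_zero_iff hq]
  rintro ⟨j, hj⟩
  have h := congrArg norm hj
  rw [← pow_succ', norm_pow, norm_one] at h
  exact (pow_lt_one₀ (norm_nonneg q) hq (Nat.succ_ne_zero j)).ne h

lemma differentiableAt_qtheta (hq : ‖q‖ < 1) {z : ℂ} (hz : z ≠ 0) :
    DifferentiableAt ℂ (qtheta q) z := by
  unfold qtheta
  refine (differentiable_qpinf hq z).mul ?_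
  exact (differentiable_qpinf hq (q / z)).fun_comp' z
    (by fun_prop (disch := exact hz) : DifferentiableAt ℂ (fun z : ℂ => q / z) z)

/-- The difference of the Appell–Lerch quotient and the Lambert series. -/
def appellDiff (q x : ℂ) : ℂ := appellQuot q x - lambertSum q x

lemma appellDiff_zpow_mul (hq : ‖q‖ < 1) (hq0 : q ≠ 0) {x : ℂ} (hx : x ≠ 0) (k : ℤ) :
    appellDiff q (q ^ k * x) = appellDiff q x := by
  have step : ∀ y ≠ 0, appellDiff q (q * y) = appellDiff q y := fun y hy => by
    rw [appellDiff, appellDiff, appellQuot_mul_left hq hq0 hy, lambertSum_mul_left hq0]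
  induction k with
  | zero => simp
  | succ i ih =>
    rw [zpow_add_one₀ hq0, mul_comm _ q, mul_assoc, step _ (mul_ne_zero (zpow_ne_zero _ hq0) hx),
      ih]
  | pred i ih =>
    rw [← ih, ← step _ (mul_ne_zero (zpow_ne_zero _ hq0) hx), ← mul_assoc, ← zpow_one_add₀ hq0,
      add_sub_cancel]

lemma appellDiff_inv (hq : ‖q‖ < 1) (hq0 : q ≠ 0) {x : ℂ} (hx : x ≠ 0) :
    appellDiff q x⁻¹ = appellDiff q x := by
  rw [appellDiff, appellDiff, appellQuot_inv hq hq0 hx, lambertSum_inv hq0 hx]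

lemma differentiableAt_sums (hq : ‖q‖ < 1) (hq0 : q ≠ 0) {x : ℂ} (hx : x ≠ 0)
    (h : ∀ n : ℤ, x * q ^ n ≠ 1) :
    DifferentiableAt ℂ (lambertSum q) x ∧ DifferentiableAt ℂ (appellSum q) x := by
  simpa using! differentiableAt_tsum_terms hq hq0 hx ∅ (by simpa using h)

lemma differentiableAt_appellDiff (hq : ‖q‖ < 1) (hq0 : q ≠ 0) {x : ℂ} (hx : x ≠ 0)
    (h : qtheta q (x ^ 2) ≠ 0) : DifferentiableAt ℂ (appellDiff q) x := by
  have h1 : ∀ n : ℤ, x * q ^ n ≠ 1 := fun n hn => by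
    refine h ?_
    rw [eq_inv_of_mul_eq_one_left hn, ← zpow_neg, ← zpow_natCast, ← zpow_mul]
    exact qtheta_zpow hq hq0 _
  obtain ⟨h2, h3⟩ := differentiableAt_sums hq hq0 hx h1
  have h4 : DifferentiableAt ℂ (fun x => qtheta q (x ^ 2)) x :=
    (differentiableAt_qtheta hq (pow_ne_zero 2 hx)).fun_comp' x
      (by fun_prop : DifferentiableAt ℂ (fun x : ℂ => x ^ 2) x)
  unfold appellDiff appellQuot
  fun_prop (disch := exact h)

/-- The entire function `(1 - e w) / w`. -/
def eSlope (w : ℂ) : ℂ := dslope (fun w => 1 - e w) 0 w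

lemma one_sub_e (w : ℂ) : 1 - e w = w * eSlope w := by
  have := sub_smul_dslope (fun w => 1 - e w) 0 w
  simp only [sub_zero, e_zero, sub_self, smul_eq_mul] at this
  exact this.symm

lemma eSlope_zero_ne_zero : eSlope 0 ≠ 0 := by
  have h : HasDerivAt (fun w => 1 - e w) _ 0 := (hasDerivAt_e 0).const_sub 1
  rw [eSlope, dslope_same, h.deriv, e_zero, mul_one]
  exact neg_ne_zero.2 Complex.two_pi_I_ne_zero

lemma differentiable_eSlope : Differentiable ℂ eSlope := by
  have h : DifferentiableOn ℂ (fun w => 1 - e w) Set.univ :=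
    ((differentiable_const 1).sub differentiable_e).differentiableOn
  exact differentiableOn_univ.1 ((Complex.differentiableOn_dslope univ_mem).2 h)

/-- The cofactor of the zero at `w = 0` of `θ(e(w)²)`. -/
def thetaCofactor (q w : ℂ) : ℂ :=
  eSlope w * (1 + e w) * (qpinf (q * e w ^ 2) q * qpinf (q / e w ^ 2) q)

lemma qtheta_e_sq (hq : ‖q‖ < 1) (w : ℂ) : qtheta q (e w ^ 2) = w * thetaCofactor q w := by
  have h : 1 - e w ^ 2 = w * eSlope w * (1 + e w) := by
    rw [← one_sub_e]
    ring
  rw [qtheta_eq hq, h, thetaCofactor]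
  ring

lemma differentiable_thetaCofactor (hq : ‖q‖ < 1) : Differentiable ℂ (thetaCofactor q) := by
  intro w
  have h1 := differentiable_eSlope w
  have h2 := differentiable_e w
  have hw : e w ^ 2 ≠ 0 := pow_ne_zero 2 (e_ne_zero w)
  have h3 : DifferentiableAt ℂ (fun w => qpinf (q * e w ^ 2) q) w :=
    (differentiable_qpinf hq (q * e w ^ 2)).fun_comp' w
      (by fun_prop : DifferentiableAt ℂ (fun w => q * e w ^ 2) w)
  have h4 : DifferentiableAt ℂ (fun w => qpinf (q / e w ^ 2) q) w :=
    (differentiable_qpinf hq (q / e w ^ 2)).fun_comp' w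
      (by fun_prop (disch := exact hw) : DifferentiableAt ℂ (fun w => q / e w ^ 2) w)
  unfold thetaCofactor
  fun_prop

lemma thetaCofactor_zero (q : ℂ) : thetaCofactor q 0 = 2 * eSlope 0 * qpinf q q ^ 2 := by
  rw [thetaCofactor, e_zero, one_pow, mul_one, div_one]
  ring

lemma thetaCofactor_zero_ne_zero (hq : ‖q‖ < 1) : thetaCofactor q 0 ≠ 0 := by
  rw [thetaCofactor_zero]
  exact mul_ne_zero (mul_ne_zero two_ne_zero eSlope_zero_ne_zero)
    (pow_ne_zero 2 (qpinf_self_ne_zero hq))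

/-- The zeros of `u ↦ θ(e(u)²)` are simple. -/
lemma exists_cofactor (hq : ‖q‖ < 1) (hq0 : q ≠ 0) {z₀ : ℂ} {k : ℤ} (hz₀ : e z₀ ^ 2 = q ^ k) :
    ∃ ρ : ℂ → ℂ, Differentiable ℂ ρ ∧ ρ 0 ≠ 0 ∧ ∀ w, qtheta q (e (z₀ + w) ^ 2) = w * ρ w := by
  obtain ⟨c, hc, h⟩ := exists_qtheta_zpow_mul hq hq0 k
  refine ⟨fun w => c * (e w ^ 2) ^ (-k) * thetaCofactor q w, fun w => ?_, ?_, fun w => ?_⟩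
  · have h1 : DifferentiableAt ℂ (fun w => (e w ^ 2) ^ (-k)) w :=
      (((differentiable_e w).fun_pow 2)).zpow (Or.inl (pow_ne_zero 2 (e_ne_zero w)))
    have h2 := differentiable_thetaCofactor hq w
    fun_prop
  · simpa [e_zero] using ⟨hc, thetaCofactor_zero_ne_zero hq⟩
  · rw [e_add, mul_pow, hz₀, h _ (pow_ne_zero 2 (e_ne_zero w)), qtheta_e_sq hq]
    ring

lemma eventually_appellDiff_mul_sq (hq : ‖q‖ < 1) (hq0 : q ≠ 0) {z₀ : ℂ} {k : ℤ}
    (hz₀ : e z₀ ^ 2 = q ^ k) :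
    ∃ h : ℂ → ℂ, DifferentiableAt ℂ h 0 ∧ h 0 = 0 ∧
      ∀ᶠ w in 𝓝[≠] (0 : ℂ), appellDiff q (e (z₀ + w)) * w ^ 2 = h w := by
  by_cases hz : ∀ n : ℤ, e z₀ * q ^ n ≠ 1
  · obtain ⟨ρ, hρ, hρ0, hθ⟩ := exists_cofactor hq hq0 hz₀
    obtain ⟨h1, h2⟩ := differentiableAt_sums hq hq0 (e_ne_zero z₀) hz
    have hadd : DifferentiableAt ℂ (fun w => e (z₀ + w)) 0 :=
      differentiable_e.comp (differentiable_id.const_add z₀) 0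
    have h1' : DifferentiableAt ℂ (fun w => lambertSum q (e (z₀ + w))) 0 :=
      DifferentiableAt.fun_comp' 0 (by simpa using h1) hadd
    have h2' : DifferentiableAt ℂ (fun w => appellSum q (e (z₀ + w))) 0 :=
      DifferentiableAt.fun_comp' 0 (by simpa using h2) hadd
    have hρ' := hρ 0
    refine ⟨fun w => w * (e (z₀ + w) * qpinf q q ^ 2 / ρ w * appellSum q (e (z₀ + w))) -
      w ^ 2 * lambertSum q (e (z₀ + w)), by fun_prop (disch := exact hρ0), by simp, ?_⟩
    filter_upwards [self_mem_nhdsWithin,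
      nhdsWithin_le_nhds (hρ'.continuousAt.eventually_ne hρ0)] with w hw hw2
    have hw0 : w ≠ 0 := hw
    rw [appellDiff, appellQuot, hθ]
    field_simp
  · push Not at hz
    obtain ⟨n, hn⟩ := hz
    have hz1 : e z₀ = q ^ (-n) := by rw [eq_inv_of_mul_eq_one_left hn, zpow_neg]
    have hJ : ∀ n ∉ ({0} : Finset ℤ), (1 : ℂ) * q ^ n ≠ 1 := fun n hn h => by
      rw [one_mul] at h
      have h' := congrArg norm h
      rw [norm_zpow, norm_one, zpow_eq_one_iff_right₀ (norm_nonneg q) hq.ne] at h'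
      exact hn (by simp [h'])
    obtain ⟨h1, h2⟩ := differentiableAt_tsum_terms hq hq0 one_ne_zero {0} hJ
    set L := fun x => ∑' n, if n ∈ ({0} : Finset ℤ) then 0 else lambertTerm q n x with hL
    set A := fun x => ∑' n, if n ∈ ({0} : Finset ℤ) then 0 else appellTerm q n x with hA
    have hLs : ∀ x ≠ 0, lambertSum q x = x / (1 - x) ^ 2 + L x := fun x hx => by
      rw [lambertSum, (summable_terms hq hq0 hx).1.tsum_eq_add_tsum_ite 0]
      simp [hL, lambertTerm]
    have hAs : ∀ x ≠ 0, appellSum q x = (1 + x) / (1 - x) + A x := fun x hx => by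
      rw [appellSum, (summable_terms hq hq0 hx).2.tsum_eq_add_tsum_ite 0]
      simp [hA, appellTerm]
    clear_value L A
    have h1' : DifferentiableAt ℂ (fun w => L (e w)) 0 :=
      DifferentiableAt.fun_comp' 0 (by simpa [e_zero] using h1) (differentiable_e 0)
    have h2' : DifferentiableAt ℂ (fun w => A (e w)) 0 :=
      DifferentiableAt.fun_comp' 0 (by simpa [e_zero] using h2) (differentiable_e 0)
    have he := differentiable_e 0
    have hε := differentiable_eSlope 0
    have hρ := differentiable_thetaCofactor hq 0
    have hε0 := eSlope_zero_ne_zero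
    have hρ0 := thetaCofactor_zero_ne_zero hq
    refine ⟨fun w => e w * qpinf q q ^ 2 / thetaCofactor q w *
      ((1 + e w) / eSlope w + w * A (e w)) - e w / eSlope w ^ 2 - w ^ 2 * L (e w), ?_, ?_, ?_⟩
    · exact ((((he.mul_const _).div hρ hρ0).mul (((he.const_add 1).div hε hε0).add
        (differentiableAt_id.mul h2'))).sub (he.div (hε.pow 2) (pow_ne_zero 2 hε0))).sub
        ((differentiableAt_id.pow 2).mul h1')
    · have := qpinf_self_ne_zero hq
      simp only [e_zero, thetaCofactor_zero]
      field_simp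
      ring
    · filter_upwards [self_mem_nhdsWithin,
        nhdsWithin_le_nhds (hρ.continuousAt.eventually_ne hρ0),
        nhdsWithin_le_nhds (hε.continuousAt.eventually_ne hε0)] with w hw hw2 hw3
      have hw0 : w ≠ 0 := hw
      rw [e_add, hz1, appellDiff_zpow_mul hq hq0 (e_ne_zero w), appellDiff, appellQuot,
        qtheta_e_sq hq, hLs _ (e_ne_zero w), hAs _ (e_ne_zero w), one_sub_e]
      field_simp
      ring

lemma eventually_differentiableAt_appellDiff (hq : ‖q‖ < 1) (hq0 : q ≠ 0) (z : ℂ) :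
    ∀ᶠ w in 𝓝[≠] z, DifferentiableAt ℂ (fun u => appellDiff q (e u)) w := by
  have hd : ∀ w, qtheta q (e w ^ 2) ≠ 0 →
      DifferentiableAt ℂ (fun u => appellDiff q (e u)) w := fun w hw =>
    (differentiableAt_appellDiff hq hq0 (e_ne_zero w) hw).fun_comp' w (differentiable_e w)
  have ht : Differentiable ℂ (fun u => qtheta q (e u ^ 2)) := fun u =>
    (differentiableAt_qtheta hq (pow_ne_zero 2 (e_ne_zero u))).fun_comp' u
      ((differentiable_e u).fun_pow 2)
  rcases (ht.analyticAt z).eventually_eq_zero_or_eventually_ne_zero with h | h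
  · exfalso
    obtain ⟨k, hk⟩ := qtheta_eq_zero hq hq0 h.self_of_nhds
    obtain ⟨ρ, hρ, hρ0, hθ⟩ := exists_cofactor hq hq0 hk
    have h1 : Tendsto (fun w => z + w) (𝓝[≠] (0 : ℂ)) (𝓝 z) := by
      have : ContinuousAt (fun w => z + w) (0 : ℂ) := by fun_prop
      simpa using this.tendsto.mono_left nhdsWithin_le_nhds
    have h2 := (h1.eventually h).and (eventually_mem_nhdsWithin.and
      (nhdsWithin_le_nhds ((hρ 0).continuousAt.eventually_ne hρ0)))
    obtain ⟨w, hw1, hw2, hw3⟩ := h2.exists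
    rw [hθ] at hw1
    exact (mul_ne_zero hw2 hw3) hw1
  · filter_upwards [h] with w hw using hd w hw

lemma appellDiff_isLittleO (hq : ‖q‖ < 1) (hq0 : q ≠ 0) (z₀ : ℂ) :
    (fun u => appellDiff q (e u)) =o[𝓝[≠] z₀] fun z => (z - z₀)⁻¹ := by
  by_cases h : qtheta q (e z₀ ^ 2) = 0
  · obtain ⟨k, hk⟩ := qtheta_eq_zero hq hq0 h
    obtain ⟨f, hf, hf0, hD⟩ := eventually_appellDiff_mul_sq hq hq0 hk
    refine isLittleO_inv_of_symmetric hf hf0 hD fun w => ?_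
    have h1 : e (z₀ - w) = q ^ k * (e (z₀ + w))⁻¹ := by
      have := e_ne_zero w
      have := e_ne_zero z₀
      rw [← hk, sub_eq_add_neg, e_add, e_add, e_neg]
      field_simp
    rw [h1, appellDiff_zpow_mul hq hq0 (inv_ne_zero (e_ne_zero _)),
      appellDiff_inv hq hq0 (e_ne_zero _)]
  · exact ((differentiableAt_appellDiff hq hq0 (e_ne_zero z₀) h).fun_comp' z₀
      (differentiable_e z₀)).continuousAt.isLittleO_sub_inv

/-- The Appell–Lerch quotient and the Lambert series differ by a constant. -/
lemma appellDiff_eq {τ : ℂ} (hτ : 0 < τ.im) {u v : ℂ} (hu : qtheta (e τ) (e u ^ 2) ≠ 0)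
    (hv : qtheta (e τ) (e v ^ 2) ≠ 0) : appellDiff (e τ) (e u) = appellDiff (e τ) (e v) := by
  have hq := norm_e_lt_one hτ
  have hq0 := e_ne_zero τ
  have h1 : Function.Periodic (fun u => appellDiff (e τ) (e u)) 1 := fun u => by
    have := e_add_int u 1
    rw [Int.cast_one] at this
    simp only [this]
  have h2 : Function.Periodic (fun u => appellDiff (e τ) (e u)) τ := fun u => by
    have := appellDiff_zpow_mul hq hq0 (e_ne_zero u) 1
    rw [zpow_one] at this
    simp only [e_add, mul_comm (e u), this]
  have hg := differentiable_limUnder (eventually_differentiableAt_appellDiff hq hq0)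
    (appellDiff_isLittleO hq hq0)
  have key := eq_of_periodic_of_differentiable hτ hg (fun z => limUnder_nhdsNE_add h1 z)
    (fun z => limUnder_nhdsNE_add h2 z) u v
  have hlim : ∀ w, qtheta (e τ) (e w ^ 2) ≠ 0 →
      limUnder (𝓝[≠] w) (fun u => appellDiff (e τ) (e u)) = appellDiff (e τ) (e w) :=
    fun w hw => (((differentiableAt_appellDiff hq hq0 (e_ne_zero w) hw).fun_comp' w
      (differentiable_e w)).continuousAt.tendsto.mono_left nhdsWithin_le_nhds).limUnder_eq
  rwa [hlim u hu, hlim v hv] at key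

end appell

section psi

variable {q : ℂ}

lemma psi26_eq (hq : ‖q‖ < 1) (hq0 : q ≠ 0) {x : ℂ} (hx0 : x ≠ 0) (hx : ∀ n : ℤ, x * q ^ n ≠ 1)
    (hmx : ∀ n : ℤ, -x * q ^ n ≠ 1) :
    psi26 q x = (q - x) / (q + x) * (x ^ 4 / q ^ 2) * appellSum q x := by
  have hshift : ∀ (a : ℂ) (n : ℤ), a / q * q ^ n = a * q ^ (n - 1) := fun a n => by
    rw [zpow_sub_one₀ hq0]
    ring
  have hxq : ∀ n : ℤ, x / q * q ^ n ≠ 1 := fun n => by rw [hshift]; exact hx _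
  have hmxq : ∀ n : ℤ, -x / q * q ^ n ≠ 1 := fun n => by rw [hshift]; exact hmx _
  have hqx : q - x ≠ 0 := fun h => hxq 0 (by rw [← sub_eq_zero.1 h]; simp [hq0])
  have hqmx : q + x ≠ 0 := fun h => hmxq 0 (by rw [← eq_neg_of_add_eq_zero_left h]; simp [hq0])
  rw [psi26, appellSum, ← tsum_mul_left,
    ← (Equiv.subRight (1 : ℤ)).tsum_eq (fun n => _ * appellTerm q n x)]
  refine tsum_congr fun n => ?_
  have h1 : qpint (-x) q n = qpint (-x / q) q n * ((1 + x * q ^ (n - 1)) / (1 + x / q)) := by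
    have := qpint_mul_left hq hq0 hmxq n
    rw [mul_div_cancel₀ _ hq0, hshift] at this
    rw [this]
    ring
  have h2 : qpint x q n = qpint (x / q) q n * ((1 - x * q ^ (n - 1)) / (1 - x / q)) := by
    have := qpint_mul_left hq hq0 hxq n
    rwa [mul_div_cancel₀ _ hq0, hshift] at this
  have h3 := qpint_ne_zero hq hq0 hxq n
  have h4 := qpint_ne_zero hq hq0 hmxq n
  have h5 : 1 - x * q ^ (n - 1) ≠ 0 := sub_ne_zero.2 (hx _).symm
  have h6 : ((-1 : ℂ) ^ n * q ^ (n * (n - 1) / 2)) ^ 4 * (x ^ 4 / q ^ 2) ^ n =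
      x ^ 4 / q ^ 2 * (q ^ (2 * (n - 1) ^ 2) * x ^ (4 * (n - 1))) := by
    have hdvd : 2 * (n * (n - 1) / 2) = n * (n - 1) :=
      Int.mul_ediv_cancel' (Int.even_mul_pred_self n).two_dvd
    have h7 : ((-1 : ℂ) ^ n) ^ 4 = 1 := by
      rw [← zpow_natCast, ← zpow_mul, mul_comm, zpow_mul]
      norm_num
    have h8 : (q ^ (n * (n - 1) / 2)) ^ 4 = q ^ (2 * (n - 1) ^ 2) * q ^ (2 * n) / q ^ 2 := by
      rw [← zpow_natCast, ← zpow_mul, ← zpow_natCast, ← zpow_add₀ hq0, ← zpow_sub₀ hq0]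
      congr 1
      push_cast
      linear_combination 2 * hdvd
    have h9 : x ^ (4 * (n - 1)) = x ^ (4 * n) / x ^ 4 := by
      rw [← zpow_natCast, ← zpow_sub₀ hx0]
      congr 1
      push_cast
      ring
    have h10 : (x ^ 4 / q ^ 2) ^ n = x ^ (4 * n) / q ^ (2 * n) := by
      rw [div_zpow, ← zpow_natCast, ← zpow_natCast, ← zpow_mul, ← zpow_mul]
      push_cast
      rfl
    have hx4 := zpow_ne_zero (4 * n) hx0
    have hq2 := zpow_ne_zero (2 * n) hq0
    rw [mul_pow, h7, h8, h9, h10]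
    generalize x ^ (4 * n) = X at *
    generalize q ^ (2 * n) = Q at *
    field_simp
  have h11 : 1 + x / q = (q + x) / q := by field_simp
  have h12 : 1 - x / q = (q - x) / q := by field_simp
  simp only [appellTerm, Equiv.subRight_apply]
  rw [mul_assoc, h6, h1, h2, qpint_zero, h11, h12]
  generalize q ^ (2 * (n - 1) ^ 2) * x ^ (4 * (n - 1)) = Y
  generalize q ^ (n - 1) = Q at *
  generalize qpint (x / q) q n = a at *
  generalize qpint (-x / q) q n = b at *
  field_simp

lemma appellQuot_eq (hq : ‖q‖ < 1) (hq0 : q ≠ 0) {x : ℂ} (hx0 : x ≠ 0)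
    (hx : ∀ n : ℤ, x * q ^ n ≠ 1) (hmx : ∀ n : ℤ, -x * q ^ n ≠ 1) :
    x / q * ((q + x) / (q - x)) * (qpinf q q ^ 2 / qtheta q (x ^ 2 / q ^ 2)) * psi26 q x =
      appellQuot q x := by
  have hqx : q - x ≠ 0 := fun h => hx (-1) (by rw [← sub_eq_zero.1 h]; simp [hq0])
  have hqmx : q + x ≠ 0 := fun h =>
    hmx (-1) (by rw [← eq_neg_of_add_eq_zero_left h]; simp [hq0])
  have hz : x ^ 2 / q ^ 2 ≠ 0 := div_ne_zero (pow_ne_zero 2 hx0) (pow_ne_zero 2 hq0)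
  have h1 : x ^ 2 = q * (q * (x ^ 2 / q ^ 2)) := by field_simp
  have h2 : qtheta q (x ^ 2) = q ^ 3 / x ^ 4 * qtheta q (x ^ 2 / q ^ 2) := by
    conv_lhs => rw [h1]
    rw [qtheta_mul_left hq hq0 (mul_ne_zero hq0 hz), qtheta_mul_left hq hq0 hz]
    field_simp
  rw [psi26_eq hq hq0 hx0 hx hmx, appellQuot, h2]
  field_simp

lemma psi66_eq (hq : ‖q‖ < 1) (hq0 : q ≠ 0) {s x y : ℂ} (hx0 : x ≠ 0) (hy0 : y ≠ 0)
    (hs : s ^ 2 = x * y) (hx : ∀ n : ℤ, x * q ^ n ≠ 1) (hy : ∀ n : ℤ, y * q ^ n ≠ 1)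
    (hxy : ∀ n : ℤ, x * y * q ^ n ≠ 1) :
    (1 - x * y) * (x - y) / ((1 - x) ^ 2 * (1 - y) ^ 2) * psi66 q s x y =
      lambertSum q x - lambertSum q y := by
  have hsq : ∀ (t : ℂ), t ^ 2 = x * y → ∀ n : ℤ, t * q ^ n ≠ 1 := fun t ht n h => by
    refine hxy (2 * n) ?_
    rw [← ht, mul_comm 2 n, zpow_mul, zpow_ofNat, ← mul_pow, h, one_pow]
  have hs1 := hsq s hs
  have hs2 := hsq (-s) (by rw [neg_sq, hs])
  have key : ∀ {a : ℂ}, (∀ n : ℤ, a * q ^ n ≠ 1) → 1 - a ≠ 0 := fun {a} ha =>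
    sub_ne_zero.2 (by simpa using (ha 0).symm)
  have hx1 := key hx
  have hy1 := key hy
  have hs1' := key hs1
  have hs2' := key hs2
  rw [lambertSum, lambertSum,
    ← (summable_terms hq hq0 hx0).1.tsum_sub (summable_terms hq hq0 hy0).1, psi66, ← tsum_mul_left]
  refine tsum_congr fun n => ?_
  have h1 : 1 - x * q ^ n ≠ 0 := sub_ne_zero.2 (hx n).symm
  have h2 : 1 - y * q ^ n ≠ 0 := sub_ne_zero.2 (hy n).symm
  have h3 := qpint_ne_zero hq hq0 hs1 n
  have h4 := qpint_ne_zero hq hq0 hs2 n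
  have h5 := qpint_ne_zero hq hq0 hx n
  have h6 := qpint_ne_zero hq hq0 hy n
  rw [lambertTerm, lambertTerm, ← mul_neg, qpint_mul_left hq hq0 hs1, qpint_mul_left hq hq0 hs2,
    qpint_mul_left hq hq0 hx, qpint_mul_left hq hq0 hy]
  generalize qpint s q n = a at *
  generalize qpint (-s) q n = b at *
  generalize qpint x q n = c at *
  generalize qpint y q n = d at *
  generalize q ^ n = Q at *
  have h7 : 1 - x * y = (1 - s) * (1 - -s) := by linear_combination hs
  have h8 : (1 - s * Q) * (1 - -s * Q) = 1 - x * y * Q ^ 2 := by linear_combination -Q ^ 2 * hs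
  calc _ = (x - y) * ((1 - s * Q) * (1 - -s * Q)) * Q / ((1 - x * Q) ^ 2 * (1 - y * Q) ^ 2) := by
        rw [h7]
        field_simp
    _ = _ := by
        rw [h8]
        field_simp
        ring

end psi

theorem stmt18 (τ u v : ℂ) (hτ : 0 < τ.im)
    (hu : ∀ m n : ℤ, u ≠ (m : ℂ) + (n : ℂ) * τ)
    (hv : ∀ m n : ℤ, v ≠ (m : ℂ) + (n : ℂ) * τ)
    (hu2 : ∀ m n : ℤ, 2 * u ≠ (m : ℂ) + (n : ℂ) * τ)
    (hv2 : ∀ m n : ℤ, 2 * v ≠ (m : ℂ) + (n : ℂ) * τ)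
    (huv : ∀ m n : ℤ, u + v ≠ (m : ℂ) + (n : ℂ) * τ)
    (q x y s : ℂ) (hq : q = e τ) (hx : x = e u) (hy : y = e v) (hs : s = e ((u + v) / 2))
    (hmx : ∀ m : ℤ, -x ≠ q ^ m) (hmy : ∀ m : ℤ, -y ≠ q ^ m)
    (hxy : ∀ m : ℤ, x / y ≠ q ^ m) :
    (1 - x * y) * (x - y) / ((1 - x) ^ 2 * (1 - y) ^ 2) * psi66 q s x y
      = x / q * ((q + x) / (q - x)) * (qpinf q q ^ 2 / qtheta q (x ^ 2 / q ^ 2)) * psi26 q x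
        - y / q * ((q + y) / (q - y)) * (qpinf q q ^ 2 / qtheta q (y ^ 2 / q ^ 2)) * psi26 q y := by
  subst hq hx hy hs
  have hq := norm_e_lt_one hτ
  have hq0 := e_ne_zero τ
  have key : ∀ w : ℂ, (∀ m n : ℤ, w ≠ (m : ℂ) + (n : ℂ) * τ) → ∀ n : ℤ, e w ≠ e τ ^ n :=
    fun w hw n h => by
      obtain ⟨m, hm⟩ := (e_eq_zpow_iff τ w n).1 h
      exact hw m n hm
  have key' : ∀ {a : ℂ}, (∀ n : ℤ, a ≠ e τ ^ n) → ∀ n : ℤ, a * e τ ^ n ≠ 1 := fun ha n h =>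
    ha (-n) (by rw [zpow_neg, eq_inv_of_mul_eq_one_left h])
  have hx := key' (key u hu)
  have hy := key' (key v hv)
  have hθ : ∀ w : ℂ, (∀ m n : ℤ, 2 * w ≠ (m : ℂ) + (n : ℂ) * τ) → qtheta (e τ) (e w ^ 2) ≠ 0 :=
    fun w hw h => by
      obtain ⟨k, hk⟩ := qtheta_eq_zero hq hq0 h
      exact key _ hw k (by rw [e_two_mul, hk])
  have hconst := appellDiff_eq hτ (hθ u hu2) (hθ v hv2)
  rw [appellDiff, appellDiff] at hconst
  rw [appellQuot_eq hq hq0 (e_ne_zero u) hx (key' hmx),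
    appellQuot_eq hq hq0 (e_ne_zero v) hy (key' hmy),
    psi66_eq hq hq0 (e_ne_zero u) (e_ne_zero v) ?_ hx hy ?_]
  · linear_combination -hconst
  · rw [← e_two_mul, ← e_add]
    congr 1
    ring
  · rw [← e_add]
    exact key' (key _ huv)
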